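/- arXiv:2109.06619 — 3 statements merged into one kernel-verified Lean document; each statement's English description precedes it below -/
import Mathlib

section
/- Let N ≥ 1 and q ∈ ℝ^N. Then there exists a unique real number τ such that Σ_{i=1}^N max(q_i − τ, 0) = 1. -/
open scoped BigOperators

/-- Wherever the sum of positive parts is positive, it strictly decreases in the threshold. -/
theorem sum_max_sub_lt_of_lt {ι : Type*} [Fintype ι] (q : ι → ℝ) {a b : ℝ} (hab : a < b)
    (hb : 0 < ∑ i, max (q i - b) 0) :
    ∑ i, max (q i - b) 0 < ∑ i, max (q i - a) 0 := by
  obtain ⟨i, hi, hpos⟩ := Finset.exists_lt_of_sum_lt (s := Finset.univ) (f := fun _ : ι => (0 : ℝ))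
    (g := fun i => max (q i - b) 0) (by simpa using hb)
  refine Finset.sum_lt_sum (fun j _ => by gcongr) ⟨i, hi, ?_⟩
  have hib : 0 < q i - b := by simpa using hpos
  rw [max_eq_left hib.le]
  exact lt_max_of_lt_left (by linarith)

/-- For any `q ∈ ℝ^N` (`N ≥ 1`) there is a unique threshold `τ ∈ ℝ` such that
`Σ_i max(q_i − τ, 0) = 1`. -/
theorem sparsemax_threshold_exists_unique {N : ℕ} (hN : 1 ≤ N) (q : Fin N → ℝ) :
    ∃! τ : ℝ, (∑ i, max (q i - τ) 0) = 1 := by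
  have : Nonempty (Fin N) := ⟨⟨0, hN⟩⟩
  obtain ⟨m, hm⟩ := Finite.exists_max q
  have hcont : Continuous fun τ : ℝ => ∑ i, max (q i - τ) 0 := by fun_prop
  have htop : ∑ i, max (q i - q m) 0 = 0 :=
    Finset.sum_eq_zero fun i _ => max_eq_right (sub_nonpos.2 (hm i))
  have hbot : 1 ≤ ∑ i, max (q i - (q m - 1)) 0 :=
    calc (1 : ℝ) ≤ max (q m - (q m - 1)) 0 := by simp
      _ ≤ _ := Finset.single_le_sum (f := fun i => max (q i - (q m - 1)) 0)
        (fun i _ => le_max_right _ _) (Finset.mem_univ m)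
  obtain ⟨τ, -, hτ⟩ := intermediate_value_Icc' (sub_le_self (q m) zero_le_one)
    hcont.continuousOn ⟨htop.le.trans zero_le_one, hbot⟩
  refine ⟨τ, hτ, fun σ hσ => ?_⟩
  dsimp only at hτ hσ
  rcases lt_trichotomy σ τ with h | h | h
  · have := sum_max_sub_lt_of_lt q h (by linarith)
    linarith
  · exact h
  · have := sum_max_sub_lt_of_lt q h (by linarith)
    linarith
end

section
/- Let N ≥ 1, q ∈ ℝ^N, and z* ∈ Δ^{N−1}. Then z* is the minimizer of ‖z − q‖² over the probability simplex Δ^{N−1} if and only if there exists τ ∈ ℝ such that z*_i = max(q_i − τ, 0) for all i = 1,…,N and Σ_{i=1}^N max(q_i − τ, 0) = 1. -/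
open scoped BigOperators

/-- If `z` minimizes the distance to `q` over the probability simplex, then `q - z` is maximal at
every coordinate in the support of `z`. -/
lemma sub_le_sub_of_forall_norm_sub_le {ι : Type*} [Fintype ι] {q z : EuclideanSpace ℝ ι}
    (hz : (∑ i, z i) = 1 ∧ ∀ i, 0 ≤ z i)
    (hmin : ∀ w : EuclideanSpace ℝ ι, ((∑ i, w i) = 1 ∧ ∀ i, 0 ≤ w i) →
      ‖z - q‖ ^ 2 ≤ ‖w - q‖ ^ 2)
    (i : ι) {k : ι} (hk : 0 < z k) : q i - z i ≤ q k - z k := by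
  classical
  obtain rfl | hik := eq_or_ne i k
  · exact le_rfl
  refine le_of_forall_pos_le_add fun ε hε ↦ ?_
  obtain ⟨t, ht, htε, htk⟩ : ∃ t : ℝ, 0 < t ∧ t ≤ ε ∧ t ≤ z k :=
    ⟨min ε (z k), lt_min hε hk, min_le_left _ _, min_le_right _ _⟩
  set d : EuclideanSpace ℝ ι := EuclideanSpace.single i 1 - EuclideanSpace.single k 1 with hd
  have hinner (x : EuclideanSpace ℝ ι) : inner ℝ x d = x i - x k := by
    simp [hd, inner_sub_right, EuclideanSpace.inner_single_right]
  have hdi : d i = 1 := by simp [hd, hik]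
  have hdk : d k = -1 := by simp [hd, hik.symm]
  have hsum : ∑ j, d j = 0 := by simp [hd]
  have hw : (∑ j, (z + t • d) j) = 1 ∧ ∀ j, 0 ≤ (z + t • d) j := by
    refine ⟨by simp [Finset.sum_add_distrib, ← Finset.mul_sum, hsum, hz.1], fun j ↦ ?_⟩
    have hzj := hz.2 j
    simp only [PiLp.add_apply, PiLp.smul_apply, smul_eq_mul]
    obtain rfl | hjk := eq_or_ne j k
    · rw [hdk]; linarith
    · have : 0 ≤ d j := by
        by_cases hji : j = i <;> simp [hd, hjk, hji, hik]
      positivity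
  have h := hmin _ hw
  rw [show z + t • d - q = (z - q) + t • d by abel, norm_add_sq_real, norm_smul, mul_pow,
    ← real_inner_self_eq_norm_sq d, inner_smul_right, hinner, hinner, hdi, hdk] at h
  simp only [PiLp.sub_apply, Real.norm_eq_abs, sq_abs] at h
  have : 0 ≤ t * ((z i - q i - (z k - q k)) + t) := by nlinarith
  have := nonneg_of_mul_nonneg_right this ht
  linarith

/-- Characterization of the Euclidean projection onto the probability simplex: `z* ∈ Δ^{N−1}`
minimizes `‖z − q‖²` over `Δ^{N−1}` if and only if there is a threshold `τ ∈ ℝ` such that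
`z*_i = max(q_i − τ, 0)` for all `i` and `Σ_i max(q_i − τ, 0) = 1`. -/
theorem sparsemax_iff_threshold {N : ℕ} (hN : 1 ≤ N) (q z : EuclideanSpace ℝ (Fin N))
    (hz : (∑ i, z i) = 1 ∧ ∀ i, 0 ≤ z i) :
    (∀ w : EuclideanSpace ℝ (Fin N), ((∑ i, w i) = 1 ∧ ∀ i, 0 ≤ w i) →
        ‖z - q‖ ^ 2 ≤ ‖w - q‖ ^ 2)
    ↔ ∃ τ : ℝ, (∀ i, z i = max (q i - τ) 0) ∧ (∑ i, max (q i - τ) 0) = 1 := by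
  constructor
  · intro hmin
    obtain ⟨k, -, hk⟩ : ∃ k ∈ Finset.univ, 0 < z k :=
      Finset.exists_lt_of_sum_lt (f := fun _ ↦ (0 : ℝ)) (by simp [hz.1])
    have key (i : Fin N) : z i = max (q i - (q k - z k)) 0 := by
      have h₁ := sub_le_sub_of_forall_norm_sub_le hz hmin i hk
      obtain h | h := (hz.2 i).eq_or_lt
      · rw [max_eq_right] <;> linarith
      · have h₂ := sub_le_sub_of_forall_norm_sub_le hz hmin k h
        rw [max_eq_left] <;> linarith
    exact ⟨q k - z k, key, by simpa only [← key] using hz.1⟩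
  · rintro ⟨τ, hτ, -⟩ w ⟨hw, hw0⟩
    simp only [EuclideanSpace.real_norm_sq_eq, PiLp.sub_apply]
    have h : ∑ i, ((z i - q i) ^ 2 + 2 * τ * z i) ≤ ∑ i, ((w i - q i) ^ 2 + 2 * τ * w i) := by
      refine Finset.sum_le_sum fun i _ ↦ ?_
      have hwi := hw0 i
      rw [hτ i]
      obtain h | h := le_total (q i - τ) 0
      · rw [max_eq_right h]; nlinarith [sq_nonneg (w i)]
      · rw [max_eq_left h]; nlinarith [sq_nonneg (w i - q i + τ)]
    simp only [Finset.sum_add_distrib, ← Finset.mul_sum, hw, hz.1] at h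
    linarith
end

section
/- Let N ≥ 1, q ∈ ℝ^N, and c ∈ ℝ. Then sparsemax(q + c·𝟙) = sparsemax(q), where 𝟙 ∈ ℝ^N is the all-ones vector; i.e., the Euclidean projection onto the probability simplex is invariant under adding a constant to every coordinate of the input. -/
open scoped BigOperators

/-- Sparsemax (the Euclidean projection onto the probability simplex) is invariant under
adding a constant `c` to every coordinate of the input: if `z₁` is the projection of `q`
and `z₂` is the projection of `q + c·𝟙`, then `z₁ = z₂`. -/
theorem sparsemax_shift_invariant {N : ℕ} (hN : 1 ≤ N)
    (q q' : EuclideanSpace ℝ (Fin N)) (c : ℝ) (hq' : ∀ i, q' i = q i + c)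
    (z₁ z₂ : EuclideanSpace ℝ (Fin N))
    (hz₁ : ((∑ i, z₁ i) = 1 ∧ ∀ i, 0 ≤ z₁ i) ∧
      ∀ w : EuclideanSpace ℝ (Fin N), ((∑ i, w i) = 1 ∧ ∀ i, 0 ≤ w i) →
        ‖z₁ - q‖ ^ 2 ≤ ‖w - q‖ ^ 2)
    (hz₂ : ((∑ i, z₂ i) = 1 ∧ ∀ i, 0 ≤ z₂ i) ∧
      ∀ w : EuclideanSpace ℝ (Fin N), ((∑ i, w i) = 1 ∧ ∀ i, 0 ≤ w i) →
        ‖z₂ - q'‖ ^ 2 ≤ ‖w - q'‖ ^ 2) :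
    z₁ = z₂ := by
  obtain ⟨⟨hs₁, hn₁⟩, h₁⟩ := hz₁
  obtain ⟨⟨hs₂, hn₂⟩, h₂⟩ := hz₂
  let m : EuclideanSpace ℝ (Fin N) := WithLp.toLp 2 fun i => (z₁ i + z₂ i) / 2
  have hm : (∑ i, m i) = 1 ∧ ∀ i, 0 ≤ m i := by
    refine ⟨?_, fun i => ?_⟩
    · simp only [m]
      rw [← Finset.sum_div, Finset.sum_add_distrib, hs₁, hs₂]
      norm_num
    · have := hn₁ i
      have := hn₂ i
      simp only [m]
      positivity
  have hle₁ := h₁ m hm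
  have hle₂ := h₂ m hm
  simp only [EuclideanSpace.norm_sq_eq, PiLp.sub_apply, Real.norm_eq_abs, sq_abs, hq', m]
    at hle₁ hle₂
  -- The shift only contributes the term `c * (∑ z₁ i - ∑ z₂ i)`, which vanishes.
  have key : ∑ i, (z₁ i - z₂ i) ^ 2 / 2 + c * (∑ i, z₁ i - ∑ i, z₂ i) =
      (∑ i, (z₁ i - q i) ^ 2 - ∑ i, ((z₁ i + z₂ i) / 2 - q i) ^ 2) +
      (∑ i, (z₂ i - (q i + c)) ^ 2 - ∑ i, ((z₁ i + z₂ i) / 2 - (q i + c)) ^ 2) := by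
    simp only [← Finset.sum_sub_distrib, Finset.mul_sum, ← Finset.sum_add_distrib]
    exact Finset.sum_congr rfl fun i _ => by ring
  rw [hs₁, hs₂] at key
  have hnonneg : ∀ i ∈ Finset.univ, 0 ≤ (z₁ i - z₂ i) ^ 2 / 2 := fun i _ => by positivity
  have hzero : ∑ i, (z₁ i - z₂ i) ^ 2 / 2 = 0 :=
    le_antisymm (by linarith) (Finset.sum_nonneg hnonneg)
  ext i
  have hi := (Finset.sum_eq_zero_iff_of_nonneg hnonneg).1 hzero i (Finset.mem_univ i)
  exact sub_eq_zero.1 (pow_eq_zero_iff two_ne_zero |>.1 (by linarith))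
end
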